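/- Let R be a commutative Noetherian ring, 𝔞 an ideal of R, and N a finitely generated R-module. Let t := cd(𝔞,N) := sup{ i ∈ ℕ : H^i_𝔞(N) ≠ 0 } and assume t is a positive integer. Then H^t_𝔞(N) = 𝔞·H^t_𝔞(N); that is, the quotient H^t_𝔞(N)/𝔞·H^t_𝔞(N) is zero. -/

import Mathlib

/-!
STATEMENT 17: Let R be a commutative Noetherian ring, 𝔞 an ideal of R, and N a finitely
generated R-module. Let t := cd(𝔞,N) := sup{ i : H^i_𝔞(N) ≠ 0 } and assume t is a positive
integer. Then H^t_𝔞(N) = 𝔞·H^t_𝔞(N), i.e. H^t_𝔞(N)/𝔞·H^t_𝔞(N) = 0.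

`t = cd(𝔞,N)` is encoded by: `H^t_𝔞(N)` is nontrivial and `H^i_𝔞(N)` is trivial for all
`i > t`.
-/

open CategoryTheory Opposite

universe u

namespace CategoryTheory.ProjectiveResolution
open Limits
variable {R : Type u} [CommRing R] {X : ModuleCat.{u} R} (P : ProjectiveResolution X)

/-- The complex `Hom(P, Y)`, seen as a chain complex in the opposite category. -/
noncomputable abbrev yonedaOpComplex (Y : ModuleCat.{u} R) : ChainComplex (ModuleCat.{u} R)ᵒᵖ ℕ :=
  ((((linearYoneda R (ModuleCat.{u} R)).obj Y).rightOp).mapHomologicalComplex _).obj P.complex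

/-- `Ext X Y` is the homology of `Hom(P, Y)`. -/
noncomputable def extOpIso (n : ℕ) (Y : ModuleCat.{u} R) :
    op (((Ext R (ModuleCat.{u} R) n).obj (op X)).obj Y) ≅ (P.yonedaOpComplex Y).homology n :=
  P.isoLeftDerivedObj ((linearYoneda R (ModuleCat.{u} R)).obj Y).rightOp n

/-- The projection from the cocycles of `Hom(P, Y)` to `Ext X Y`. -/
noncomputable def cocyclesToExt (n : ℕ) (Y : ModuleCat.{u} R) :
    ((P.yonedaOpComplex Y).opcycles n).unop ⟶ ((Ext R (ModuleCat.{u} R) n).obj (op X)).obj Y :=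
  ((P.extOpIso n Y).hom ≫ (P.yonedaOpComplex Y).homologyι n).unop

/-- The inclusion of the cocycles of `Hom(P, Y)` in the module of cochains. -/
noncomputable def cocyclesι (n : ℕ) (Y : ModuleCat.{u} R) :
    ((P.yonedaOpComplex Y).opcycles n).unop ⟶ ModuleCat.of R (P.complex.X n ⟶ Y) :=
  ((P.yonedaOpComplex Y).pOpcycles n).unop

instance (n : ℕ) (Y : ModuleCat.{u} R) : Mono (P.cocyclesι n Y) :=
  unop_mono_of_epi ((P.yonedaOpComplex Y).pOpcycles n)

instance (n : ℕ) (Y : ModuleCat.{u} R) : Epi (P.cocyclesToExt n Y) := by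
  unfold cocyclesToExt; infer_instance

lemma cocyclesι_injective (n : ℕ) (Y : ModuleCat.{u} R) : Function.Injective (P.cocyclesι n Y) :=
  (ModuleCat.mono_iff_injective _).1 inferInstance

lemma cocyclesToExt_surjective (n : ℕ) (Y : ModuleCat.{u} R) :
    Function.Surjective (P.cocyclesToExt n Y) :=
  (ModuleCat.epi_iff_surjective _).1 inferInstance

lemma exists_cocyclesι_eq {n : ℕ} {Y : ModuleCat.{u} R} (f : P.complex.X n ⟶ Y)
    (hf : P.complex.d (n + 1) n ≫ f = 0) : ∃ z, P.cocyclesι n Y z = f := by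
  have := (ShortComplex.mk _ _ ((P.yonedaOpComplex Y).d_pOpcycles (n + 1) n)).exact_of_g_is_cokernel
    ((P.yonedaOpComplex Y).opcyclesIsCokernel (n + 1) n (by simp))
  have := (ShortComplex.moduleCat_exact_iff _).1 this.unop
  exact this f hf

lemma d_comp_cocyclesι {n : ℕ} {Y : ModuleCat.{u} R} (z) :
    P.complex.d (n + 1) n ≫ (show P.complex.X n ⟶ Y from P.cocyclesι n Y z) = 0 := by
  have : P.cocyclesι n Y ≫ (ModuleCat.ofHom (Linear.leftComp R Y (P.complex.d (n+1) n))) = 0 := by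
    have := congrArg Quiver.Hom.unop ((P.yonedaOpComplex Y).d_pOpcycles (n+1) n)
    exact this
  exact congr($this z)

lemma cocyclesToExt_eq_zero_iff {n : ℕ} {Y : ModuleCat.{u} R} (z) :
    P.cocyclesToExt (n + 1) Y z = 0 ↔ ∃ g : P.complex.X n ⟶ Y,
      P.complex.d (n + 1) n ≫ g = P.cocyclesι (n + 1) Y z := by
  have := (ShortComplex.mk _ _
      ((P.yonedaOpComplex Y).homologyι_comp_fromOpcycles (n + 1) n)).exact_of_f_is_kernel
    ((P.yonedaOpComplex Y).homologyIsKernel (n + 1) n (by simp))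
  have h₁ := (ShortComplex.moduleCat_exact_iff _).1 this.unop
  have h₂ : ∀ g : P.complex.X n ⟶ Y, P.cocyclesι (n + 1) Y
      (((P.yonedaOpComplex Y).fromOpcycles (n + 1) n).unop g) = P.complex.d (n + 1) n ≫ g := by
    intro g
    have := congrArg Quiver.Hom.unop ((P.yonedaOpComplex Y).p_fromOpcycles (n + 1) n)
    exact congr($this g)
  have h₃ : P.cocyclesToExt (n + 1) Y z = 0 ↔
      ((P.yonedaOpComplex Y).homologyι (n + 1)).unop z = 0 := by
    have hi : Function.Injective (P.extOpIso (n + 1) Y).hom.unop :=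
      (ModuleCat.mono_iff_injective _).1 inferInstance
    rw [← map_eq_zero_iff _ hi]
    rfl
  rw [h₃]
  constructor
  · intro h
    obtain ⟨g, hg⟩ := h₁ z h
    exact ⟨g, (h₂ g).symm.trans congr(P.cocyclesι (n + 1) Y $hg)⟩
  · rintro ⟨g, hg⟩
    rw [← h₂] at hg
    obtain rfl := P.cocyclesι_injective _ _ hg
    have := congrArg Quiver.Hom.unop
      ((P.yonedaOpComplex Y).homologyι_comp_fromOpcycles (n + 1) n)
    exact congr($this g)

lemma map_cocyclesToExt {n : ℕ} {Y Y' : ModuleCat.{u} R} (g : Y ⟶ Y') (z z')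
    (h : P.cocyclesι n Y' z' = (show P.complex.X n ⟶ Y from P.cocyclesι n Y z) ≫ g) :
    (((Ext R (ModuleCat.{u} R) n).obj (op X)).map g) (P.cocyclesToExt n Y z) =
      P.cocyclesToExt n Y' z' := by
  let φ : P.yonedaOpComplex Y' ⟶ P.yonedaOpComplex Y := (NatTrans.mapHomologicalComplex
    (NatTrans.rightOp ((linearYoneda R (ModuleCat.{u} R)).map g)) _).app P.complex
  have h₁ : (HomologicalComplex.opcyclesMap φ n).unop z = z' := by
    apply P.cocyclesι_injective
    rw [h]
    have := congrArg Quiver.Hom.unop (HomologicalComplex.p_opcyclesMap φ n)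
    exact congr($this z)
  have h₂ := ProjectiveResolution.leftDerived_app_eq
    (NatTrans.rightOp ((linearYoneda R (ModuleCat.{u} R)).map g)) P n
  have h₃ : ((Ext R (ModuleCat.{u} R) n).obj (op X)).map g =
    ((P.extOpIso n Y').hom ≫ HomologicalComplex.homologyMap φ n ≫ (P.extOpIso n Y).inv).unop :=
    congrArg Quiver.Hom.unop h₂
  have h₄ : ((P.extOpIso n Y').hom ≫ HomologicalComplex.homologyMap φ n ≫ (P.extOpIso n Y).inv) ≫
     (P.extOpIso n Y).hom ≫ (P.yonedaOpComplex Y).homologyι n =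
     ((P.extOpIso n Y').hom ≫ (P.yonedaOpComplex Y').homologyι n) ≫
        HomologicalComplex.opcyclesMap φ n := by simp
  rw [h₃, ← h₁]
  have := congrArg Quiver.Hom.unop h₄
  exact congr($this z)

lemma map_op_cocyclesToExt {n : ℕ} {Y X' : ModuleCat.{u} R} {g : X' ⟶ X}
    (P' : ProjectiveResolution X') (φ : Hom P' P g) (z z')
    (h : P'.cocyclesι n Y z' = φ.hom.f n ≫ (show P.complex.X n ⟶ Y from P.cocyclesι n Y z)) :
    (((Ext R (ModuleCat.{u} R) n).map g.op).app Y) (P.cocyclesToExt n Y z) =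
      P'.cocyclesToExt n Y z' := by
  let ψ : P'.yonedaOpComplex Y ⟶ P.yonedaOpComplex Y :=
    (Functor.mapHomologicalComplex _ _).map φ.hom
  have h₁ : (HomologicalComplex.opcyclesMap ψ n).unop z = z' := by
    apply P'.cocyclesι_injective
    rw [h]
    have := congrArg Quiver.Hom.unop (HomologicalComplex.p_opcyclesMap ψ n)
    exact congr($this z)
  have h₂ := ProjectiveResolution.isoLeftDerivedObj_hom_naturality g P' P φ.hom
    φ.hom_f_zero_comp_π_f_zero
    ((linearYoneda R (ModuleCat.{u} R)).obj Y).rightOp n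
  have h₄ : (((linearYoneda R (ModuleCat.{u} R)).obj Y).rightOp.leftDerived n).map g ≫
     (P.extOpIso n Y).hom ≫ (P.yonedaOpComplex Y).homologyι n =
     ((P'.extOpIso n Y).hom ≫ (P'.yonedaOpComplex Y).homologyι n) ≫
        HomologicalComplex.opcyclesMap ψ n := by
    rw [Category.assoc, ← HomologicalComplex.homologyι_naturality]
    exact congr($h₂ ≫ (P.yonedaOpComplex Y).homologyι n)
  rw [← h₁]
  have := congrArg Quiver.Hom.unop h₄
  exact congr($this z)

/-- The class in `Abelian.Ext X Y n` of a cocycle of `Hom(P, Y)`. -/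
noncomputable def cocyclesToAbelianExt {n : ℕ} {Y : ModuleCat.{u} R}
    (z : ((P.yonedaOpComplex Y).opcycles n).unop) : Abelian.Ext X Y n :=
  P.extMk (P.cocyclesι n Y z) (n + 1) rfl (P.d_comp_cocyclesι z)

lemma cocyclesToAbelianExt_surjective {n : ℕ} {Y : ModuleCat.{u} R} (α : Abelian.Ext X Y n) :
    ∃ z, P.cocyclesToAbelianExt z = α := by
  obtain ⟨f, hf, rfl⟩ := P.extMk_surjective α (n + 1) rfl
  obtain ⟨z, rfl⟩ := P.exists_cocyclesι_eq f hf
  exact ⟨z, rfl⟩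

lemma cocyclesToAbelianExt_add {n : ℕ} {Y : ModuleCat.{u} R}
    (z z' : ((P.yonedaOpComplex Y).opcycles n).unop) :
    P.cocyclesToAbelianExt (z + z') = P.cocyclesToAbelianExt z + P.cocyclesToAbelianExt z' := by
  unfold cocyclesToAbelianExt
  rw [add_extMk]
  congr 1
  exact map_add (P.cocyclesι n Y).hom z z'

lemma cocyclesToAbelianExt_eq_zero_iff {n : ℕ} {Y : ModuleCat.{u} R}
    (z : ((P.yonedaOpComplex Y).opcycles (n + 1)).unop) :
    P.cocyclesToAbelianExt z = 0 ↔ P.cocyclesToExt (n + 1) Y z = 0 := by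
  rw [cocyclesToExt_eq_zero_iff]
  exact P.extMk_eq_zero_iff _ _ _ _ n rfl

end CategoryTheory.ProjectiveResolution

namespace CategoryTheory.Abelian.Ext
open ProjectiveResolution
variable {R : Type u} [CommRing R]

lemma cocyclesToExt_eq_of_cocyclesToAbelianExt_eq {X Y : ModuleCat.{u} R}
    (P : ProjectiveResolution X) {n : ℕ} {z z'}
    (h : P.cocyclesToAbelianExt (n := n + 1) (Y := Y) z = P.cocyclesToAbelianExt z') :
    P.cocyclesToExt (n + 1) Y z = P.cocyclesToExt (n + 1) Y z' := by
  have h' : P.cocyclesToAbelianExt ((z - z') + z') = P.cocyclesToAbelianExt z' := by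
    rw [sub_add_cancel]; exact h
  rw [cocyclesToAbelianExt_add, add_eq_right, cocyclesToAbelianExt_eq_zero_iff] at h'
  exact sub_eq_zero.1 ((map_sub (P.cocyclesToExt (n + 1) Y).hom z z').symm.trans h')

/-- The comparison map from the `Ext`-groups defined by the derived category to those defined as
derived functors. -/
noncomputable def toExt {X Y : ModuleCat.{u} R} {n : ℕ} (α : Abelian.Ext X Y n) :
    ((_root_.Ext R (ModuleCat.{u} R) n).obj (op X)).obj Y :=
  (projectiveResolution X).cocyclesToExt n Y
    ((projectiveResolution X).cocyclesToAbelianExt_surjective α).choose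

lemma toExt_cocyclesToAbelianExt {X Y : ModuleCat.{u} R} {n : ℕ}
    (z : (((projectiveResolution X).yonedaOpComplex Y).opcycles (n + 1)).unop) :
    ((projectiveResolution X).cocyclesToAbelianExt z).toExt =
      (projectiveResolution X).cocyclesToExt (n + 1) Y z :=
  cocyclesToExt_eq_of_cocyclesToAbelianExt_eq _
    ((projectiveResolution X).cocyclesToAbelianExt_surjective _).choose_spec

variable {X Y : ModuleCat.{u} R} {n : ℕ}

lemma toExt_surjective :
    Function.Surjective (toExt : Abelian.Ext X Y (n + 1) → _) := by
  intro x
  obtain ⟨z, rfl⟩ := (projectiveResolution X).cocyclesToExt_surjective (n + 1) Y x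
  exact ⟨_, toExt_cocyclesToAbelianExt z⟩

lemma toExt_add (α β : Abelian.Ext X Y (n + 1)) : (α + β).toExt = α.toExt + β.toExt := by
  obtain ⟨z, rfl⟩ := (projectiveResolution X).cocyclesToAbelianExt_surjective α
  obtain ⟨w, rfl⟩ := (projectiveResolution X).cocyclesToAbelianExt_surjective β
  rw [← cocyclesToAbelianExt_add]
  simp only [toExt_cocyclesToAbelianExt]
  exact map_add ((projectiveResolution X).cocyclesToExt (n + 1) Y).hom z w

lemma toExt_eq_zero_iff (α : Abelian.Ext X Y (n + 1)) : α.toExt = 0 ↔ α = 0 := by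
  obtain ⟨z, rfl⟩ := (projectiveResolution X).cocyclesToAbelianExt_surjective α
  rw [toExt_cocyclesToAbelianExt, cocyclesToAbelianExt_eq_zero_iff]

lemma map_toExt {Y' : ModuleCat.{u} R} (g : Y ⟶ Y') (α : Abelian.Ext X Y (n + 1)) :
    ((_root_.Ext R (ModuleCat.{u} R) (n + 1)).obj (op X)).map g α.toExt =
      (α.comp (mk₀ g) (add_zero _)).toExt := by
  obtain ⟨z, rfl⟩ := (projectiveResolution X).cocyclesToAbelianExt_surjective α
  obtain ⟨z', hz'⟩ := (projectiveResolution X).exists_cocyclesι_eq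
    ((show (projectiveResolution X).complex.X (n + 1) ⟶ Y from
      (projectiveResolution X).cocyclesι (n + 1) Y z) ≫ g) (by
        rw [← Category.assoc, d_comp_cocyclesι, Limits.zero_comp])
  have : ((projectiveResolution X).cocyclesToAbelianExt z).comp (mk₀ g) (add_zero _) =
      (projectiveResolution X).cocyclesToAbelianExt z' := by
    unfold cocyclesToAbelianExt
    rw [extMk_comp_mk₀]
    congr 1
    exact hz'.symm
  rw [this, toExt_cocyclesToAbelianExt, toExt_cocyclesToAbelianExt]
  exact map_cocyclesToExt _ g z z' hz'

lemma map_op_toExt {X' : ModuleCat.{u} R} (g : X' ⟶ X) (α : Abelian.Ext X Y (n + 1)) :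
    ((_root_.Ext R (ModuleCat.{u} R) (n + 1)).map g.op).app Y α.toExt =
      ((mk₀ g).comp α (zero_add _)).toExt := by
  obtain ⟨z, rfl⟩ := (projectiveResolution X).cocyclesToAbelianExt_surjective α
  let φ : Hom (projectiveResolution X') (projectiveResolution X) g :=
    ⟨lift g _ _, by rw [ChainComplex.single₀_map_f_zero]; exact lift_commutes_zero g _ _⟩
  obtain ⟨z', hz'⟩ := (projectiveResolution X').exists_cocyclesι_eq
    (φ.hom.f (n + 1) ≫ (show (projectiveResolution X).complex.X (n + 1) ⟶ Y from
      (projectiveResolution X).cocyclesι (n + 1) Y z)) (by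
        rw [← φ.hom.comm_assoc, d_comp_cocyclesι, Limits.comp_zero])
  have : (mk₀ g).comp ((projectiveResolution X).cocyclesToAbelianExt z) (zero_add _) =
      (projectiveResolution X').cocyclesToAbelianExt z' := by
    unfold cocyclesToAbelianExt
    rw [mk₀_comp_extMk _ _ _ _ φ]
    congr 1
    exact hz'.symm
  rw [this, toExt_cocyclesToAbelianExt, toExt_cocyclesToAbelianExt]
  exact (map_op_cocyclesToExt _ _ φ z z' hz' :)

/-- The functor `Ext(X, -)` sends multiplication by a scalar to multiplication by this scalar. -/
lemma ext_map_smul_id (r : R) (x : ((_root_.Ext R (ModuleCat.{u} R) n).obj (op X)).obj Y) :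
    ((_root_.Ext R (ModuleCat.{u} R) n).obj (op X)).map (r • 𝟙 Y) x = r • x := by
  obtain ⟨z, rfl⟩ := (projectiveResolution X).cocyclesToExt_surjective n Y x
  refine (map_cocyclesToExt _ _ z (r • z) ?_).trans
    (map_smul ((projectiveResolution X).cocyclesToExt n Y).hom r z)
  refine (map_smul ((projectiveResolution X).cocyclesι n Y).hom r z).trans ?_
  rw [Linear.comp_smul, Category.comp_id]

end CategoryTheory.Abelian.Ext

namespace localCohomology
open Limits
variable {R : Type u} [CommRing R] (𝔞 : Ideal R)

/-- The module `R ⧸ 𝔞 ^ s`. -/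
noncomputable abbrev powQuot (s : ℕ) : ModuleCat.{u} R :=
  (ringModIdeals (idealPowersDiagram 𝔞)).obj (op s)

/-- The projection between the quotients of `R` by two powers of `𝔞`. -/
noncomputable abbrev powQuotMap {s s' : ℕ} (h : s ≤ s') : powQuot 𝔞 s' ⟶ powQuot 𝔞 s :=
  (ringModIdeals (idealPowersDiagram 𝔞)).map (homOfLE h).op

/-- The map from `Ext (R ⧸ 𝔞 ^ s) M` to local cohomology. -/
noncomputable def ι (i s : ℕ) (M : ModuleCat.{u} R) :
    ((Ext R (ModuleCat.{u} R) i).obj (op (powQuot 𝔞 s))).obj M ⟶ (localCohomology 𝔞 i).obj M :=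
  (colimit.ι (diagram (idealPowersDiagram 𝔞) i) (op (op s))).app M

/-- Local cohomology of `M` is the colimit of the modules `Ext (R ⧸ 𝔞 ^ s) M`. -/
noncomputable def isColimitObj (i : ℕ) (M : ModuleCat.{u} R) :
    IsColimit (((evaluation _ _).obj M).mapCocone
      (colimit.cocone (diagram (idealPowersDiagram 𝔞) i))) :=
  isColimitOfPreserves _ (colimit.isColimit _)

noncomputable instance : PreservesFilteredColimitsOfSize.{0, 0} (forget (ModuleCat.{u} R)) :=
  preservesFilteredColimitsOfSize_shrink.{0, u, 0, u} _

variable {𝔞} {n : ℕ} {M : ModuleCat.{u} R}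

/-- The local cohomology class of an extension class of `R ⧸ 𝔞 ^ s` by `M`. -/
noncomputable def ofExt {s : ℕ} (α : Abelian.Ext (powQuot 𝔞 s) M n) :
    (localCohomology 𝔞 n).obj M :=
  ι 𝔞 n s M α.toExt

lemma exists_ofExt_eq (x : (localCohomology 𝔞 (n + 1)).obj M) :
    ∃ (s : ℕ) (α : Abelian.Ext (powQuot 𝔞 s) M (n + 1)), ofExt α = x := by
  obtain ⟨j, y, rfl⟩ := Concrete.isColimit_exists_rep _ (isColimitObj 𝔞 (n + 1) M) x
  obtain ⟨α, rfl⟩ := Abelian.Ext.toExt_surjective y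
  exact ⟨j.unop.unop, α, rfl⟩

lemma ofExt_add {s : ℕ} (α β : Abelian.Ext (powQuot 𝔞 s) M (n + 1)) :
    ofExt (α + β) = ofExt α + ofExt β := by
  unfold ofExt
  rw [Abelian.Ext.toExt_add]
  exact map_add (ι 𝔞 (n + 1) s M).hom _ _

lemma ofExt_zero {s : ℕ} : ofExt (0 : Abelian.Ext (powQuot 𝔞 s) M (n + 1)) = 0 := by
  unfold ofExt
  rw [(Abelian.Ext.toExt_eq_zero_iff _).2 rfl]
  exact map_zero (ι 𝔞 (n + 1) s M).hom

lemma ofExt_comp {s s' : ℕ} (h : s ≤ s') (α : Abelian.Ext (powQuot 𝔞 s) M (n + 1)) :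
    ofExt ((Abelian.Ext.mk₀ (powQuotMap 𝔞 h)).comp α (zero_add _)) = ofExt α := by
  unfold ofExt
  rw [← Abelian.Ext.map_op_toExt]
  have := NatTrans.congr_app
    (colimit.w (diagram (idealPowersDiagram 𝔞) (n + 1)) (homOfLE h).op.op) M
  exact congr($this α.toExt)

lemma ofExt_eq_zero {s : ℕ} {α : Abelian.Ext (powQuot 𝔞 s) M (n + 1)} (hα : ofExt α = 0) :
    ∃ (s' : ℕ) (h : s ≤ s'),
      (Abelian.Ext.mk₀ (powQuotMap 𝔞 h)).comp α (zero_add _) = 0 := by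
  have h₀ : (ι 𝔞 (n + 1) s M) α.toExt = (ι 𝔞 (n + 1) s M) 0 :=
    hα.trans (map_zero (ι 𝔞 (n + 1) s M).hom).symm
  obtain ⟨k, f, g, hfg⟩ := Concrete.isColimit_exists_of_rep_eq _ (isColimitObj 𝔞 (n + 1) M) _ _ h₀
  refine ⟨k.unop.unop, leOfHom f.unop.unop, ?_⟩
  rw [← Abelian.Ext.toExt_eq_zero_iff, ← Abelian.Ext.map_op_toExt]
  exact hfg.trans (map_zero _)

lemma map_ofExt {s : ℕ} {M' : ModuleCat.{u} R} (g : M ⟶ M')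
    (α : Abelian.Ext (powQuot 𝔞 s) M (n + 1)) :
    (localCohomology 𝔞 (n + 1)).map g (ofExt α) =
      ofExt (α.comp (Abelian.Ext.mk₀ g) (add_zero _)) := by
  unfold ofExt
  rw [← Abelian.Ext.map_toExt]
  have := (colimit.ι (diagram (idealPowersDiagram 𝔞) (n + 1)) (op (op s))).naturality g
  exact congr($this α.toExt).symm

lemma map_smul_id (r : R) (x : (localCohomology 𝔞 (n + 1)).obj M) :
    (localCohomology 𝔞 (n + 1)).map (r • 𝟙 M) x = r • x := by
  obtain ⟨s, α, rfl⟩ := exists_ofExt_eq x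
  have := (colimit.ι (diagram (idealPowersDiagram 𝔞) (n + 1)) (op (op s))).naturality (r • 𝟙 M)
  refine (congr($this α.toExt)).symm.trans ?_
  refine Eq.trans ?_ (map_smul (ι 𝔞 (n + 1) s M).hom r α.toExt)
  exact congr(ι 𝔞 (n + 1) s M $(Abelian.Ext.ext_map_smul_id r α.toExt))

lemma map_add_hom {M' : ModuleCat.{u} R} (f g : M ⟶ M') (x : (localCohomology 𝔞 (n + 1)).obj M) :
    (localCohomology 𝔞 (n + 1)).map (f + g) x =
      (localCohomology 𝔞 (n + 1)).map f x + (localCohomology 𝔞 (n + 1)).map g x := by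
  obtain ⟨s, α, rfl⟩ := exists_ofExt_eq x
  simp only [map_ofExt]
  rw [← ofExt_add, Abelian.Ext.mk₀_add, Abelian.Ext.comp_add]

variable {S : ShortComplex (ModuleCat.{u} R)}

lemma exact_map (hS : S.ShortExact)
    (x : (localCohomology 𝔞 (n + 1)).obj S.X₂)
    (hx : (localCohomology 𝔞 (n + 1)).map S.g x = 0) :
    ∃ y, (localCohomology 𝔞 (n + 1)).map S.f y = x := by
  obtain ⟨s, α, rfl⟩ := exists_ofExt_eq x
  rw [map_ofExt] at hx
  obtain ⟨s', h, h₀⟩ := ofExt_eq_zero hx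
  rw [← Abelian.Ext.comp_assoc _ _ _ (zero_add _) (add_zero _) (by simp)] at h₀
  obtain ⟨β, hβ⟩ := Abelian.Ext.covariant_sequence_exact₂ _ hS _ h₀
  exact ⟨ofExt β, by rw [map_ofExt, hβ, ofExt_comp]⟩

lemma map_g_surjective (hS : S.ShortExact)
    (h₁ : Subsingleton ((localCohomology 𝔞 (n + 2)).obj S.X₁)) :
    Function.Surjective ((localCohomology 𝔞 (n + 1)).map S.g) := by
  intro x
  obtain ⟨s, α, rfl⟩ := exists_ofExt_eq x
  obtain ⟨s', h, h₀⟩ := ofExt_eq_zero (Subsingleton.elim (ofExt (α.comp hS.extClass rfl)) 0)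
  rw [← Abelian.Ext.comp_assoc _ _ _ (zero_add _) rfl (by lia)] at h₀
  obtain ⟨β, hβ⟩ := Abelian.Ext.covariant_sequence_exact₃ _ hS _ rfl h₀
  exact ⟨ofExt β, by rw [map_ofExt, hβ, ofExt_comp]⟩

lemma subsingleton_X₂ (hS : S.ShortExact)
    (h₁ : Subsingleton ((localCohomology 𝔞 (n + 1)).obj S.X₁))
    (h₃ : Subsingleton ((localCohomology 𝔞 (n + 1)).obj S.X₃)) :
    Subsingleton ((localCohomology 𝔞 (n + 1)).obj S.X₂) := by
  refine subsingleton_of_forall_eq 0 fun x ↦ ?_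
  obtain ⟨y, rfl⟩ := exact_map hS x (Subsingleton.elim _ _)
  rw [Subsingleton.elim y 0]
  exact map_zero ((localCohomology 𝔞 (n + 1)).map S.f).hom

lemma subsingleton_X₃ (hS : S.ShortExact)
    (h₂ : Subsingleton ((localCohomology 𝔞 (n + 1)).obj S.X₂))
    (h₁ : Subsingleton ((localCohomology 𝔞 (n + 2)).obj S.X₁)) :
    Subsingleton ((localCohomology 𝔞 (n + 1)).obj S.X₃) :=
  (map_g_surjective hS h₁).subsingleton

end localCohomology

namespace CategoryTheory.Abelian.Ext
variable {R : Type u} [CommRing R]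

lemma exists_forall_comp_eq_zero_of_projective {S : ShortComplex (ModuleCat.{u} R)}
    (hS : S.ShortExact) [Projective S.X₂] {M : ModuleCat.{u} R} {n : ℕ}
    (ξ : Abelian.Ext S.X₃ M (n + 1)) :
    ∃ η : Abelian.Ext S.X₁ M n, ∀ (S' : ShortComplex (ModuleCat.{u} R)), S'.ShortExact →
      ∀ φ : S' ⟶ S, (mk₀ φ.τ₁).comp η (zero_add _) = 0 →
        (mk₀ φ.τ₃).comp ξ (zero_add _) = 0 := by
  obtain ⟨η, rfl⟩ := contravariant_sequence_exact₃ hS _ ξ (eq_zero_of_projective _) (add_comm 1 n)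
  refine ⟨η, fun S' hS' φ h ↦ ?_⟩
  rw [← comp_assoc _ _ _ (zero_add 1) (add_comm 1 n) (by lia),
    ← ShortComplex.ShortExact.extClass_naturality hS' hS,
    comp_assoc _ _ _ (add_zero 1) (zero_add n) (by lia), h, comp_zero]

variable [IsNoetherianRing R] (𝔞 : Ideal R)

/-- If `𝔞` annihilates `M`, every extension class of a finitely generated module by `M`
dies on `𝔞 ^ m • X` for some `m`. -/
lemma exists_pow_forall_comp_eq_zero {M : ModuleCat.{u} R} (hM : ∀ r ∈ 𝔞, ∀ x : M, r • x = 0)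
    (n : ℕ) (X : ModuleCat.{u} R) [Module.Finite R X] (ξ : Abelian.Ext X M n) :
    ∃ m : ℕ, ∀ (W : ModuleCat.{u} R) (f : W ⟶ X),
      (∀ w, f w ∈ (𝔞 ^ m • ⊤ : Submodule R X)) → (mk₀ f).comp ξ (zero_add _) = 0 := by
  induction n generalizing X with
  | zero =>
    obtain ⟨g, rfl⟩ := (mk₀_bijective X M).2 ξ
    refine ⟨1, fun W f hf ↦ ?_⟩
    rw [mk₀_comp_mk₀, mk₀_eq_zero_iff]
    ext w
    have : (𝔞 ^ 1 • ⊤ : Submodule R X) ≤ LinearMap.ker g.hom := by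
      rw [pow_one, Submodule.smul_le]
      intro r hr x _
      simp [hM r hr]
    exact this (hf w)
  | succ n ih =>
    obtain ⟨k, p, hp⟩ := Module.Finite.exists_fin' R X
    have hS := LinearMap.shortExact_shortComplexKer hp
    have : Projective p.shortComplexKer.X₂ :=
      inferInstanceAs (Projective (ModuleCat.of R (Fin k → R)))
    obtain ⟨η, hη⟩ := exists_forall_comp_eq_zero_of_projective hS ξ
    have : Module.Finite R p.shortComplexKer.X₁ :=
      inferInstanceAs (Module.Finite R (LinearMap.ker p))
    obtain ⟨m, hm⟩ := ih _ η
    obtain ⟨l, hl⟩ := Ideal.exists_pow_inf_eq_pow_smul 𝔞 (LinearMap.ker p)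
    refine ⟨m + l, fun W f hf ↦ ?_⟩
    let q : (𝔞 ^ (m + l) • ⊤ : Submodule R (Fin k → R)) →ₗ[R]
        (𝔞 ^ (m + l) • ⊤ : Submodule R X) := p.restrict fun x hx ↦ by
      have := Submodule.mem_map_of_mem (f := p) hx
      rw [Submodule.map_smul''] at this
      exact Submodule.smul_mono le_rfl le_top this
    have hq : Function.Surjective q := by
      rintro ⟨x, hx⟩
      have : x ∈ Submodule.map p (𝔞 ^ (m + l) • ⊤) := by
        rwa [Submodule.map_smul'', Submodule.map_top, LinearMap.range_eq_top.2 hp]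
      obtain ⟨y, hy, rfl⟩ := this
      exact ⟨⟨y, hy⟩, rfl⟩
    let i : LinearMap.ker q →ₗ[R] LinearMap.ker p :=
      LinearMap.codRestrict _ ((Submodule.subtype _) ∘ₗ (Submodule.subtype _)) fun x ↦
        congr_arg Subtype.val x.2
    let φ : q.shortComplexKer ⟶ p.shortComplexKer :=
      { τ₁ := ModuleCat.ofHom i
        τ₂ := ModuleCat.ofHom (Submodule.subtype _)
        τ₃ := ModuleCat.ofHom (Submodule.subtype _)
        comm₁₂ := rfl
        comm₂₃ := rfl }
    have h := hη _ (LinearMap.shortExact_shortComplexKer hq) φ (hm _ _ fun w ↦ ?_)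
    · have hfac : f = ModuleCat.ofHom (LinearMap.codRestrict _ f.hom hf) ≫ φ.τ₃ := rfl
      rw [hfac, ← mk₀_comp_mk₀, comp_assoc _ _ _ (zero_add 0) (zero_add _) (by lia), h, comp_zero]
    · have h₁ : (w.1.1 : Fin k → R) ∈ 𝔞 ^ (m + l) • ⊤ ⊓ LinearMap.ker p := ⟨w.1.2, (i w).2⟩
      rw [hl _ (by lia), Nat.add_sub_cancel] at h₁
      have h₂ := Submodule.smul_mono le_rfl inf_le_right h₁
      rw [← (LinearMap.ker p).range_subtype, ← Submodule.map_top, ← Submodule.map_smul''] at h₂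
      obtain ⟨y, hy, hy'⟩ := h₂
      obtain rfl : y = i w := Subtype.ext hy'
      exact hy

end CategoryTheory.Abelian.Ext

namespace localCohomology
variable {R : Type u} [CommRing R] [IsNoetherianRing R] {𝔞 : Ideal R}

/-- Higher local cohomology with respect to `𝔞` vanishes on modules annihilated by `𝔞`. -/
lemma subsingleton_of_smul_eq_zero {M : ModuleCat.{u} R} (hM : ∀ r ∈ 𝔞, ∀ x : M, r • x = 0)
    (n : ℕ) : Subsingleton ((localCohomology 𝔞 (n + 1)).obj M) := by
  refine subsingleton_of_forall_eq 0 fun x ↦ ?_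
  obtain ⟨s, α, rfl⟩ := exists_ofExt_eq x
  have hS (s : ℕ) := LinearMap.shortExact_shortComplexKer (Submodule.mkQ_surjective (𝔞 ^ s))
  have : Projective (Submodule.mkQ (𝔞 ^ s)).shortComplexKer.X₂ :=
    inferInstanceAs (Projective (ModuleCat.of R R))
  obtain ⟨η, hη⟩ := Abelian.Ext.exists_forall_comp_eq_zero_of_projective (hS s) α
  have : Module.Finite R (Submodule.mkQ (𝔞 ^ s)).shortComplexKer.X₁ :=
    inferInstanceAs (Module.Finite R (LinearMap.ker (Submodule.mkQ (𝔞 ^ s))))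
  obtain ⟨m, hm⟩ := Abelian.Ext.exists_pow_forall_comp_eq_zero 𝔞 hM _ _ η
  have hle : LinearMap.ker (Submodule.mkQ (𝔞 ^ (s + m))) ≤
      LinearMap.ker (Submodule.mkQ (𝔞 ^ s)) := by
    simpa using Ideal.pow_le_pow_right (Nat.le_add_right s m)
  let φ : (Submodule.mkQ (𝔞 ^ (s + m))).shortComplexKer ⟶ (Submodule.mkQ (𝔞 ^ s)).shortComplexKer :=
    { τ₁ := ModuleCat.ofHom (Submodule.inclusion hle)
      τ₂ := 𝟙 _
      τ₃ := powQuotMap 𝔞 (Nat.le_add_right s m)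
      comm₁₂ := rfl
      comm₂₃ := rfl }
  rw [← ofExt_comp (Nat.le_add_right s m)]
  refine (congrArg ofExt (hη _ (hS _) φ (hm _ _ fun w ↦ ?_))).trans ofExt_zero
  have h₁ : (w.1 : R) ∈ 𝔞 ^ m • LinearMap.ker (Submodule.mkQ (𝔞 ^ s)) := by
    have := (Submodule.ker_mkQ (𝔞 ^ (s + m))).le w.2
    rw [Submodule.ker_mkQ]
    rwa [smul_eq_mul, ← pow_add, add_comm]
  rw [← (LinearMap.ker (Submodule.mkQ (𝔞 ^ s))).range_subtype, ← Submodule.map_top,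
    ← Submodule.map_smul''] at h₁
  obtain ⟨y, hy, hy'⟩ := h₁
  obtain rfl : y = Submodule.inclusion hle w := Subtype.ext hy'
  exact hy

end localCohomology

namespace localCohomology
variable {R : Type u} [CommRing R]

lemma shortExact_of_linearMap {A B C : Type u} [AddCommGroup A] [AddCommGroup B] [AddCommGroup C]
    [Module R A] [Module R B] [Module R C] {f : A →ₗ[R] B} {g : B →ₗ[R] C}
    (hf : Function.Injective f) (hfg : Function.Exact f g) (hg : Function.Surjective g) :
    (ModuleCat.shortComplexOfCompEqZero f g hfg.linearMap_comp_eq_zero).ShortExact where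
  exact := (ShortComplex.ShortExact.moduleCat_exact_iff_function_exact _).2 hfg
  mono_f := (ModuleCat.mono_iff_injective _).2 hf
  epi_g := (ModuleCat.epi_iff_surjective _).2 hg

section Cone

variable {C : ℕ → ModuleCat.{u} R} (d : ∀ j, C (j + 1) →ₗ[R] C j) (x : R)

variable (C) in
/-- The terms of the mapping cone of multiplication by a scalar on a chain complex. -/
def coneObj : ℕ → ModuleCat.{u} R
  | 0 => C 0
  | j + 1 => ModuleCat.of R (C (j + 1) × C j)

/-- The differentials of the mapping cone of multiplication by `x`. -/
def coneD : ∀ j, coneObj C (j + 1) →ₗ[R] coneObj C j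
  | 0 => (d 0).coprod (x • LinearMap.id)
  | j + 1 => ((d (j + 1)).coprod (x • LinearMap.id)).prod (-(d j ∘ₗ LinearMap.snd R _ _))

/-- Multiplication by `x` is null-homotopic on the chain complex with differentials `d`. -/
def IsNullHomotopicSMul : Prop :=
  ∃ h : ∀ j, C j →ₗ[R] C (j + 1), (∀ c, d 0 (h 0 c) = x • c) ∧
    ∀ j c, d (j + 1) (h (j + 1) c) + h j (d j c) = x • c

variable {d x}

lemma coneD_comp_coneD (hd : ∀ j c, d j (d (j + 1) c) = 0) (j : ℕ) (c : coneObj C (j + 2)) :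
    coneD d x j (coneD d x (j + 1) c) = 0 := by
  match j, c with
  | 0, (u, v) =>
    change d 0 (d 1 u + x • v) + x • -(d 0 v) = 0
    simp [hd]
  | j + 1, (u, v) =>
    change ((d (j + 1) (d (j + 2) u + x • v) + x • -(d (j + 1) v), -(d j (-(d (j + 1) v)))) :
      C (j + 1) × C j) = 0
    simp [hd]

lemma isNullHomotopicSMul_coneD_self : IsNullHomotopicSMul (coneD d x) x := by
  refine ⟨fun
    | 0 => LinearMap.inr R _ _
    | j + 1 => LinearMap.inr R _ _ ∘ₗ LinearMap.fst R _ _, fun c ↦ ?_, fun j c ↦ ?_⟩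
  · have (c : C 0) : d 0 0 + x • c = x • c := by simp
    exact this c
  · match j, c with
    | 0, (u, v) =>
      have : ((d 1 0 + x • u, -(d 0 u)) : C 1 × C 0) + (0, d 0 u + x • v) = (x • u, x • v) :=
        Prod.ext (by simp) (by simp)
      exact this
    | j + 1, (u, v) =>
      have : ((d (j + 2) 0 + x • u, -(d (j + 1) u)) : C (j + 2) × C (j + 1)) +
          (0, d (j + 1) u + x • v) = (x • u, x • v) := Prod.ext (by simp) (by simp)
      exact this

lemma IsNullHomotopicSMul.coneD {y : R} (hy : IsNullHomotopicSMul d y) :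
    IsNullHomotopicSMul (coneD d x) y := by
  obtain ⟨h, h₀, hs⟩ := hy
  refine ⟨fun
    | 0 => LinearMap.inl R _ _ ∘ₗ h 0
    | j + 1 => (h (j + 1)).prodMap (-(h j)), fun c ↦ ?_, fun j c ↦ ?_⟩
  · have (c : C 0) : d 0 (h 0 c) + x • (0 : C 0) = y • c := by rw [h₀, smul_zero, add_zero]
    exact this c
  · match j, c with
    | 0, (u, v) =>
      have : ((d 1 (h 1 u) + x • -(h 0 v), -(d 0 (-(h 0 v)))) : C 1 × C 0) +
          (h 0 (d 0 u + x • v), 0) = (y • u, y • v) :=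
        Prod.ext (by simp [← hs 0 u]; abel) (by simpa using h₀ v)
      exact this
    | j + 1, (u, v) =>
      have : ((d (j + 2) (h (j + 2) u) + x • -(h (j + 1) v), -(d (j + 1) (-(h (j + 1) v)))) :
          C (j + 2) × C (j + 1)) + (h (j + 1) (d (j + 1) u + x • v), -(h j (-(d j v)))) =
            (y • u, y • v) :=
        Prod.ext (by simp [← hs (j + 1) u]; abel) (by simpa using hs j v)
      exact this

end Cone

variable {𝔞 : Ideal R}

lemma subsingleton_prod {n : ℕ} {M N : ModuleCat.{u} R}
    (hM : Subsingleton ((localCohomology 𝔞 (n + 1)).obj M))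
    (hN : Subsingleton ((localCohomology 𝔞 (n + 1)).obj N)) :
    Subsingleton ((localCohomology 𝔞 (n + 1)).obj (ModuleCat.of R (M × N))) :=
  subsingleton_X₂ (shortExact_of_linearMap (f := LinearMap.inl R M N) (g := LinearMap.snd R M N)
    LinearMap.inl_injective .inl_snd LinearMap.snd_surjective) hM hN

lemma map_fst_comp_add_snd_smul_mem {n : ℕ} {M N : ModuleCat.{u} R} {f : M ⟶ N} {x : R}
    (hx : x ∈ 𝔞) (hf : ∀ y, (localCohomology 𝔞 (n + 1)).map f y ∈
      (𝔞 • ⊤ : Submodule R ((localCohomology 𝔞 (n + 1)).obj N)))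
    (y : (localCohomology 𝔞 (n + 1)).obj (ModuleCat.of R (M × N))) :
    (localCohomology 𝔞 (n + 1)).map (ModuleCat.ofHom (LinearMap.fst R M N) ≫ f +
      ModuleCat.ofHom (LinearMap.snd R M N) ≫ (x • 𝟙 N)) y ∈
        (𝔞 • ⊤ : Submodule R ((localCohomology 𝔞 (n + 1)).obj N)) := by
  rw [map_add_hom, Functor.map_comp, Functor.map_comp, ModuleCat.comp_apply, ModuleCat.comp_apply,
    map_smul_id]
  exact add_mem (hf _) (Submodule.smul_mem_smul hx trivial)

lemma subsingleton_range {n : ℕ} {M N : ModuleCat.{u} R} (f : M →ₗ[R] N)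
    (hM : Subsingleton ((localCohomology 𝔞 (n + 1)).obj M))
    (hf : Subsingleton ((localCohomology 𝔞 (n + 2)).obj (ModuleCat.of R (LinearMap.ker f)))) :
    Subsingleton ((localCohomology 𝔞 (n + 1)).obj (ModuleCat.of R (LinearMap.range f))) :=
  subsingleton_X₃ (shortExact_of_linearMap (f := (LinearMap.ker f).subtype) (g := f.rangeRestrict)
    (Submodule.subtype_injective _) (LinearMap.exact_iff.2 (by simp)) f.surjective_rangeRestrict)
    hM hf

variable [IsNoetherianRing R]

lemma subsingleton_of_subsingleton (M : ModuleCat.{u} R) [Subsingleton M] (n : ℕ) :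
    Subsingleton ((localCohomology 𝔞 (n + 1)).obj M) :=
  subsingleton_of_smul_eq_zero (fun _ _ _ ↦ Subsingleton.elim _ _) n

/-- A Koszul-type resolution: a bounded complex starting at `N`, built from copies of `N`, on which
the elements of `l` act null-homotopically. -/
lemma exists_complex {n : ℕ} (N : ModuleCat.{u} R)
    (hN : ∀ i, n < i → Subsingleton ((localCohomology 𝔞 (i + 1)).obj N))
    (l : List R) (hl : ∀ x ∈ l, x ∈ 𝔞) :
    ∃ (C : ℕ → ModuleCat.{u} R) (d : ∀ j, C (j + 1) →ₗ[R] C j), C 0 = N ∧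
      (∀ j c, d j (d (j + 1) c) = 0) ∧
      (∃ k, ∀ j, k ≤ j → Subsingleton (C j)) ∧
      (∀ j i, n < i → Subsingleton ((localCohomology 𝔞 (i + 1)).obj (C j))) ∧
      (∀ x ∈ l, IsNullHomotopicSMul d x) ∧
      ∀ y, (localCohomology 𝔞 (n + 1)).map (ModuleCat.ofHom (d 0)) y ∈
        (𝔞 • ⊤ : Submodule R ((localCohomology 𝔞 (n + 1)).obj (C 0))) := by
  induction l with
  | nil =>
    let C : ℕ → ModuleCat.{u} R
      | 0 => N
      | _ + 1 => ModuleCat.of R PUnit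
    have (j : ℕ) : Subsingleton (C (j + 1)) := inferInstanceAs (Subsingleton PUnit)
    refine ⟨C, fun _ ↦ 0, rfl, fun _ _ ↦ rfl, ⟨1, ?_⟩, ?_, by simp, fun y ↦ ?_⟩
    · rintro (_ | j) hj
      · lia
      · exact this j
    · rintro (_ | j) i hi
      · exact hN i hi
      · exact subsingleton_of_subsingleton _ _
    · have := subsingleton_of_subsingleton (𝔞 := 𝔞) (C (0 + 1)) n
      rw [Subsingleton.elim y 0, map_zero]
      exact zero_mem _
  | cons x l ih =>
    obtain ⟨C, d, hC, hd, ⟨k, hk⟩, hH, hl', hr⟩ := ih fun y hy ↦ hl y (List.mem_cons_of_mem _ hy)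
    refine ⟨coneObj C, coneD d x, hC, coneD_comp_coneD hd, ⟨k + 1, ?_⟩, ?_, ?_,
      map_fst_comp_add_snd_smul_mem (hl x List.mem_cons_self) hr⟩
    · rintro (_ | j) hj
      · lia
      · have := hk j (by lia)
        have := hk (j + 1) (by lia)
        exact inferInstanceAs (Subsingleton (C (j + 1) × C j))
    · rintro (_ | j) i hi
      · exact hH 0 i hi
      · exact subsingleton_prod (hH (j + 1) i hi) (hH j i hi)
    · intro y hy
      obtain rfl | hy := List.mem_cons.1 hy
      · exact isNullHomotopicSMul_coneD_self
      · exact (hl' y hy).coneD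

lemma subsingleton_of_smul_le {n : ℕ} {M : ModuleCat.{u} R} {A B : Submodule R M} (hAB : A ≤ B)
    (h : 𝔞 • B ≤ A) (hA : Subsingleton ((localCohomology 𝔞 (n + 1)).obj (ModuleCat.of R A))) :
    Subsingleton ((localCohomology 𝔞 (n + 1)).obj (ModuleCat.of R B)) := by
  refine subsingleton_X₂ (shortExact_of_linearMap (f := Submodule.inclusion hAB)
    (g := (A.submoduleOf B).mkQ) (Submodule.inclusion_injective _)
    (LinearMap.exact_iff.2 ((Submodule.ker_mkQ _).trans (Submodule.range_inclusion _ _ hAB).symm))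
    (Submodule.mkQ_surjective _)) hA (subsingleton_of_smul_eq_zero ?_ n)
  intro r hr y
  obtain ⟨b, rfl⟩ := Submodule.mkQ_surjective _ y
  change (A.submoduleOf B).mkQ (r • b) = 0
  rw [Submodule.mkQ_apply, Submodule.Quotient.mk_eq_zero]
  exact h (Submodule.smul_mem_smul hr b.2)

lemma map_ofHom_surjective {n : ℕ} {M N : ModuleCat.{u} R} (f : M →ₗ[R] N)
    (hf : Subsingleton ((localCohomology 𝔞 (n + 2)).obj (ModuleCat.of R (LinearMap.ker f))))
    (h : 𝔞 • ⊤ ≤ LinearMap.range f) :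
    Function.Surjective ((localCohomology 𝔞 (n + 1)).map (ModuleCat.ofHom f)) := by
  intro y
  have h₀ : Subsingleton ((localCohomology 𝔞 (n + 1)).obj
      (ModuleCat.of R (N ⧸ LinearMap.range f))) := by
    refine subsingleton_of_smul_eq_zero (fun r hr y ↦ ?_) n
    obtain ⟨b, rfl⟩ := Submodule.mkQ_surjective _ y
    change (LinearMap.range f).mkQ (r • b) = 0
    rw [Submodule.mkQ_apply, Submodule.Quotient.mk_eq_zero]
    exact h (Submodule.smul_mem_smul hr trivial)
  obtain ⟨z, rfl⟩ := exact_map (𝔞 := 𝔞) (shortExact_of_linearMap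
    (f := (LinearMap.range f).subtype) (g := (LinearMap.range f).mkQ)
    (Submodule.subtype_injective _) (LinearMap.exact_iff.2 (by simp))
    (Submodule.mkQ_surjective _)) y
    (Subsingleton.elim _ _)
  obtain ⟨w, rfl⟩ := map_g_surjective (𝔞 := 𝔞) (shortExact_of_linearMap
    (f := (LinearMap.ker f).subtype) (g := f.rangeRestrict)
    (Submodule.subtype_injective _) (LinearMap.exact_iff.2 (by simp))
    f.surjective_rangeRestrict) hf z
  refine ⟨w, ?_⟩
  have : ModuleCat.ofHom f =
      ModuleCat.ofHom f.rangeRestrict ≫ ModuleCat.ofHom (LinearMap.range f).subtype := rfl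
  rw [this, Functor.map_comp]
  rfl

/-- If the elements of `l` generate `𝔞` and act null-homotopically, the local cohomology of the
cycles of a bounded complex vanishes above the range in which that of its terms does. -/
lemma subsingleton_ker {n : ℕ} {C : ℕ → ModuleCat.{u} R} {d : ∀ j, C (j + 1) →ₗ[R] C j}
    (hd : ∀ j c, d j (d (j + 1) c) = 0) {k : ℕ} (hk : ∀ j, k ≤ j → Subsingleton (C j))
    (hH : ∀ j i, n < i → Subsingleton ((localCohomology 𝔞 (i + 1)).obj (C j)))
    (hker : ∀ j, 𝔞 • LinearMap.ker (d j) ≤ LinearMap.range (d (j + 1))) (j : ℕ) :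
    Subsingleton ((localCohomology 𝔞 (n + j + 2)).obj (ModuleCat.of R (LinearMap.ker (d j)))) := by
  induction hm : k - j generalizing j with
  | zero =>
    have := hk (j + 1) (by lia)
    have : Subsingleton (ModuleCat.of R (LinearMap.ker (d j))) :=
      inferInstanceAs (Subsingleton (LinearMap.ker (d j)))
    exact subsingleton_of_subsingleton _ _
  | succ m ih =>
    refine subsingleton_of_smul_le ?_ (hker j)
      (subsingleton_range _ (hH (j + 2) (n + j + 1) (by lia)) (ih (j + 1) (by lia)))
    rintro _ ⟨c, rfl⟩
    exact hd j c

end localCohomology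

theorem smul_top_eq_top_of_cohomological_dimension
    {R : Type u} [CommRing R] [IsNoetherianRing R] (𝔞 : Ideal R)
    (N : Type u) [AddCommGroup N] [Module R N] [Module.Finite R N]
    (t : ℕ) (h_pos : 0 < t)
    (h_nontriv : Nontrivial ((localCohomology 𝔞 t).obj (ModuleCat.of R N)))
    (h_vanish : ∀ i, t < i → Subsingleton ((localCohomology 𝔞 i).obj (ModuleCat.of R N))) :
    (𝔞 • ⊤ : Submodule R ((localCohomology 𝔞 t).obj (ModuleCat.of R N))) = ⊤ := by
  obtain ⟨n, rfl⟩ := Nat.exists_eq_succ_of_ne_zero h_pos.ne'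
  clear h_nontriv
  generalize ModuleCat.of R N = N at *
  obtain ⟨s, rfl⟩ := (IsNoetherian.noetherian 𝔞 : 𝔞.FG)
  obtain ⟨C, d, rfl, hd, ⟨k, hk⟩, hH, hl, hr⟩ := localCohomology.exists_complex (n := n) N
    (fun i hi ↦ h_vanish (i + 1) (by lia)) s.toList fun x hx ↦
      Submodule.subset_span (Finset.mem_toList.1 hx)
  have hs (x) (hx : x ∈ s) := hl x (Finset.mem_toList.2 hx)
  have hker (j : ℕ) :
      Ideal.span (s : Set R) • LinearMap.ker (d j) ≤ LinearMap.range (d (j + 1)) := by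
    rw [Ideal.span, Submodule.span_smul_eq, Submodule.set_smul_le_iff]
    intro x c hx hc
    obtain ⟨h, -, h₁⟩ := hs x hx
    refine ⟨h (j + 1) c, ?_⟩
    rw [← h₁, LinearMap.mem_ker.1 hc, map_zero, add_zero]
  have hcoker : Ideal.span (s : Set R) • ⊤ ≤ LinearMap.range (d 0) := by
    rw [Ideal.span, Submodule.span_smul_eq, Submodule.set_smul_le_iff]
    intro x c hx _
    obtain ⟨h, h₀, -⟩ := hs x hx
    exact ⟨h 0 c, h₀ c⟩
  refine eq_top_iff.2 fun y _ ↦ ?_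
  obtain ⟨z, rfl⟩ := localCohomology.map_ofHom_surjective (d 0)
    (localCohomology.subsingleton_ker hd hk hH hker 0) hcoker y
  exact hr z
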